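/- Let z₁, z₂, z₃, z₄ be pairwise distinct nonzero real numbers; write J = {1,2,3,4} and P = 16·z₁·z₂·z₃·z₄. For i ≠ j set A_{ij} = 1/(4·z_i·z_j·(z_i−z_j)²); for pairwise distinct a, b, i set B_{abi} = −1/(16·z_a³·z_b³·z_i³); and set W₄ = 3·(z₁^{−2}+z₂^{−2}+z₃^{−2}+z₄^{−2})/(64·(z₁z₂z₃z₄)³). Regard all of these as functions of (z₁,z₂,z₃,z₄) and let ∂_{z_i} denote the partial derivative in the i-th variable. Then 0 = P·W₄ − ∑_{i∈J} ∑_{(I₁,I₂)} (1/2)·∂_{z_i}[P·w(I₁,i)·w(I₂,i)] + ∑_{i≠j in J} ∑_{(a,b)} (1/2)·∂_{z_i}∂_{z_j}[P·A_{ij}·A_{ai}·A_{bj}] + ∑_{i∈J} ∑_{(a,b,c)} (1/6)·∂_{z_i}∂_{z_i}[P·A_{ai}·A_{bi}·A_{ci}], where the second sum is over ordered pairs (I₁,I₂) of disjoint nonempty sets with I₁ ∪ I₂ = J∖{i}, with w({a},i) = A_{ai} and w({a,b},i) = B_{abi}; the third sum is over ordered pairs (i,j) with i ≠ j and ordered pairs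 (a,b) with {a,b} = J∖{i,j}; and the fourth sum is over ordered triples (a,b,c) with {a,b,c} = J∖{i}. -/

import Mathlib

open Finset

/-- Partial derivative in the `i`-th variable of a function of four real variables. -/
noncomputable def pd (i : Fin 4) (F : (Fin 4 → ℝ) → ℝ) (p : Fin 4 → ℝ) : ℝ :=
  deriv (fun t => F (Function.update p i t)) (p i)

/-- `P = 16·z₁·z₂·z₃·z₄`. -/
noncomputable def Pfun (p : Fin 4 → ℝ) : ℝ := 16 * p 0 * p 1 * p 2 * p 3

/-- `A_{ij} = 1/(4·z_i·z_j·(z_i−z_j)²)`. -/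
noncomputable def Afun (i j : Fin 4) (p : Fin 4 → ℝ) : ℝ :=
  1 / (4 * p i * p j * (p i - p j) ^ 2)

/-- `B_{abi} = −1/(16·z_a³·z_b³·z_i³)`. -/
noncomputable def Bfun (a b i : Fin 4) (p : Fin 4 → ℝ) : ℝ :=
  -1 / (16 * p a ^ 3 * p b ^ 3 * p i ^ 3)

/-- `W₄ = 3·(z₁^{−2}+z₂^{−2}+z₃^{−2}+z₄^{−2})/(64·(z₁z₂z₃z₄)³)`. -/
noncomputable def W4fun (p : Fin 4 → ℝ) : ℝ :=
  3 * ((p 0) ^ (-2 : ℤ) + (p 1) ^ (-2 : ℤ) + (p 2) ^ (-2 : ℤ) + (p 3) ^ (-2 : ℤ)) /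
    (64 * (p 0 * p 1 * p 2 * p 3) ^ 3)

/-- `w({a},i) = A_{ai}` and `w({a,b},i) = B_{abi}` (the latter is symmetric in `a`, `b`). -/
noncomputable def wfun (I : Finset (Fin 4)) (i : Fin 4) : (Fin 4 → ℝ) → ℝ :=
  if h1 : I.card = 1 then Afun (I.min' (Finset.card_pos.mp (by omega))) i
  else if h2 : I.card = 2 then
    Bfun (I.min' (Finset.card_pos.mp (by omega))) (I.max' (Finset.card_pos.mp (by omega))) i
  else fun _ => 0

noncomputable def pathT (a i j b : ℝ) : ℝ :=
  i⁻¹*j⁻¹*((i-j)⁻¹*(i-a)⁻¹*(j-b)⁻¹)^2 *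
   ((-i⁻¹-2*(i-j)⁻¹-2*(i-a)⁻¹)*(-j⁻¹-2*(j-i)⁻¹-2*(j-b)⁻¹) - 2*((i-j)⁻¹)^2)
noncomputable def starT (i a b c : ℝ) : ℝ :=
  (i⁻¹*(i-a)⁻¹*(i-b)⁻¹*(i-c)⁻¹)^2 *
   ((-2*i⁻¹-2*(i-a)⁻¹-2*(i-b)⁻¹-2*(i-c)⁻¹)^2 + 2*(i⁻¹)^2
     + 2*((i-a)⁻¹)^2+2*((i-b)⁻¹)^2+2*((i-c)⁻¹)^2)

theorem path_pf (i w j k : ℝ) (hi : i ≠ 0) (hw : w ≠ 0) (hj : j ≠ 0)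
   (h1 : w - i ≠ 0) (h2 : w - j ≠ 0) (h3 : j - i ≠ 0) (h4 : j - k ≠ 0) (AG AG' CG CG' EG EG' : ℝ)
   (hAG : AG = (j⁻¹*(j-i)⁻¹*(j-k)⁻¹)^2) (hAG' : AG' = AG*(-2*j⁻¹-2*(j-i)⁻¹-2*(j-k)⁻¹))
   (hCG : CG = i⁻¹*j⁻¹*((j-i)⁻¹*(j-k)⁻¹)^2) (hCG' : CG' = CG*(-j⁻¹-2*(j-i)⁻¹-2*(j-k)⁻¹))
   (hEG : EG = j⁻¹*(j⁻¹*i⁻¹*(j-k)⁻¹)^2) (hEG' : EG' = EG*(-3*j⁻¹-2*(j-k)⁻¹)) :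
   pathT i w j k = -2*AG'*((w-j)⁻¹)^3 - 6*AG*((w-j)⁻¹)^4
     - (-AG'*(j⁻¹+2*(j-i)⁻¹)+AG*((j⁻¹)^2+2*((j-i)⁻¹)^2))*((w-j)⁻¹)^2
     + 2*AG*(j⁻¹+2*(j-i)⁻¹)*((w-j)⁻¹)^3
     - 2*CG'*((w-i)⁻¹)^3 - (-CG'*(i⁻¹-2*(j-i)⁻¹) - 2*CG*((j-i)⁻¹)^2)*((w-i)⁻¹)^2
     - EG'*(w⁻¹)^2 := by
  subst hAG' hCG' hEG'
  subst hAG hCG hEG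
  have e : j - w = -(w-j) := by ring
  simp only [pathT, e]
  field_simp
  ring

theorem star_pf (w x y z A B C : ℝ) (hw : w ≠ 0) (hx : x ≠ 0) (hy : y ≠ 0) (hz : z ≠ 0)
   (h1 : w - x ≠ 0) (h2 : w - y ≠ 0) (h3 : w - z ≠ 0)
   (h4 : x - y ≠ 0) (h5 : x - z ≠ 0) (h6 : y - z ≠ 0)
   (hA : A = (x⁻¹*(x-y)⁻¹*(x-z)⁻¹)^2) (hB : B = (y⁻¹*(x-y)⁻¹*(y-z)⁻¹)^2)
   (hC : C = (z⁻¹*(x-z)⁻¹*(y-z)⁻¹)^2) :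
   starT w x y z = 6*A*((w-x)⁻¹)^4 - 4*A*(x⁻¹+(x-y)⁻¹+(x-z)⁻¹)*((w-x)⁻¹)^3
    + 6*B*((w-y)⁻¹)^4 - 4*B*(y⁻¹-(x-y)⁻¹+(y-z)⁻¹)*((w-y)⁻¹)^3
    + 6*C*((w-z)⁻¹)^4 - 4*C*(z⁻¹-(x-z)⁻¹-(y-z)⁻¹)*((w-z)⁻¹)^3
    + (x⁻¹*y⁻¹*z⁻¹)^2*(6*(w⁻¹)^4+4*(x⁻¹+y⁻¹+z⁻¹)*(w⁻¹)^3) := by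
  subst hA hB hC
  simp only [starT]
  field_simp
  ring

theorem pair_id (a b : ℝ) (ha : a ≠ 0) (hb : b ≠ 0) (h : a - b ≠ 0) :
    3*(a⁻¹)^4*((a-b)⁻¹)^2 + 2*(a⁻¹)^3*((a-b)⁻¹)^3 + 3*(b⁻¹)^4*((a-b)⁻¹)^2
      - 2*(b⁻¹)^3*((a-b)⁻¹)^3
      = (a⁻¹*b⁻¹)^2*(3*(a⁻¹)^2+4*a⁻¹*b⁻¹+3*(b⁻¹)^2) := by
  field_simp
  ring

theorem tree_sum (x y z w : ℝ) (hx : x ≠ 0) (hy : y ≠ 0) (hz : z ≠ 0) (hw : w ≠ 0)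
    (h1 : w - x ≠ 0) (h2 : w - y ≠ 0) (h3 : w - z ≠ 0)
    (h4 : x - y ≠ 0) (h5 : x - z ≠ 0) (h6 : y - z ≠ 0) :
    pathT x w y z + pathT x w z y + pathT y w x z + pathT y w z x + pathT z w x y + pathT z w y x
    + pathT w x y z + pathT w x z y + pathT w y x z + pathT w y z x + pathT w z x y + pathT w z y x
    + starT x y z w + starT y x z w + starT z x y w + starT w x y z
    = (x⁻¹*y⁻¹*z⁻¹*w⁻¹)^2 * (6*((x⁻¹)^2+(y⁻¹)^2+(z⁻¹)^2+(w⁻¹)^2)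
      + 4*(x⁻¹*y⁻¹+x⁻¹*z⁻¹+x⁻¹*w⁻¹+y⁻¹*z⁻¹+y⁻¹*w⁻¹+z⁻¹*w⁻¹)) := by
  have f1 : x - w = -(w-x) := by ring
  have f2 : y - w = -(w-y) := by ring
  have f3 : z - w = -(w-z) := by ring
  have f4 : y - x = -(x-y) := by ring
  have f5 : z - x = -(x-z) := by ring
  have f6 : z - y = -(y-z) := by ring
  have e4 : y - x ≠ 0 := by rw [f4]; exact neg_ne_zero.mpr h4
  have e5 : z - x ≠ 0 := by rw [f5]; exact neg_ne_zero.mpr h5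
  have e6 : z - y ≠ 0 := by rw [f6]; exact neg_ne_zero.mpr h6
  rw [path_pf x w y z hx hw hy h1 h2 e4 h6 _ _ _ _ _ _ rfl rfl rfl rfl rfl rfl,
    path_pf x w z y hx hw hz h1 h3 e5 e6 _ _ _ _ _ _ rfl rfl rfl rfl rfl rfl,
    path_pf y w x z hy hw hx h2 h1 h4 h5 _ _ _ _ _ _ rfl rfl rfl rfl rfl rfl,
    path_pf y w z x hy hw hz h2 h3 e6 e5 _ _ _ _ _ _ rfl rfl rfl rfl rfl rfl,
    path_pf z w x y hz hw hx h3 h1 h5 h4 _ _ _ _ _ _ rfl rfl rfl rfl rfl rfl,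
    path_pf z w y x hz hw hy h3 h2 h6 e4 _ _ _ _ _ _ rfl rfl rfl rfl rfl rfl,
    star_pf w x y z _ _ _ hw hx hy hz h1 h2 h3 h4 h5 h6 rfl rfl rfl]
  have p1 := pair_id x y hx hy h4
  have p2 := pair_id x z hx hz h5
  have p3 := pair_id y z hy hz h6
  simp only [pathT, starT, f1, f2, f3, f4, f5, f6, inv_neg]
  generalize (w-x)⁻¹ = p at *
  generalize (w-y)⁻¹ = q at *
  generalize (w-z)⁻¹ = r at *
  generalize (x-y)⁻¹ = U at *
  generalize (x-z)⁻¹ = V at *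
  generalize (y-z)⁻¹ = W at *
  generalize x⁻¹ = a at *
  generalize y⁻¹ = b at *
  generalize z⁻¹ = c at *
  generalize w⁻¹ = s at *
  linear_combination (s*c)^2 * p1 + (s*b)^2*p2 + (s*a)^2*p3

/-- The configurations at which all the rational functions are regular. -/
def Good (p : Fin 4 → ℝ) : Prop := (∀ i, p i ≠ 0) ∧ ∀ i j, i ≠ j → p i - p j ≠ 0

theorem good_eventually (p : Fin 4 → ℝ) (hp : Good p) (i : Fin 4) :
    ∀ᶠ t in nhds (p i), Good (Function.update p i t) := by
  have hc : Continuous (fun t : ℝ => Function.update p i t) := by fun_prop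
  have hk : ∀ k, Continuous (fun t : ℝ => Function.update p i t k) :=
    fun k => (continuous_apply k).comp hc
  have hu : Function.update p i (p i) = p := Function.update_eq_self i p
  refine Filter.Eventually.and ?_ ?_
  · rw [Filter.eventually_all]
    intro k
    exact (hk k).continuousAt.eventually_ne (by simpa [hu] using hp.1 k)
  · simp only [Filter.eventually_all]
    intro k l hkl
    exact ((hk k).sub (hk l)).continuousAt.eventually_ne (by simpa [hu] using hp.2 k l hkl)

theorem pd_of_good {F G : (Fin 4 → ℝ) → ℝ} (h : ∀ q, Good q → F q = G q) (i : Fin 4)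
    {p : Fin 4 → ℝ} (hp : Good p) {D : ℝ}
    (hD : HasDerivAt (fun t => G (Function.update p i t)) D (p i)) : pd i F p = D := by
  unfold pd
  rw [← hD.deriv]
  apply Filter.EventuallyEq.deriv_eq
  filter_upwards [good_eventually p hp i] with t ht using h _ ht

theorem hd_inv (t : ℝ) (h : t ≠ 0) : HasDerivAt (fun t : ℝ => t⁻¹) (-(t⁻¹)^2) t := by
  simpa using hasDerivAt_inv h

theorem hd_sub (t c : ℝ) (h : t - c ≠ 0) :
    HasDerivAt (fun t : ℝ => (t-c)⁻¹) (-((t-c)⁻¹)^2) t := by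
  have := (hd_inv (t-c) h).comp t ((hasDerivAt_id t).sub_const c)
  simpa [Function.comp_def] using this

theorem hd_of {f : ℝ → ℝ} {a b t : ℝ} (h : HasDerivAt f a t) (e : b = a) :
    HasDerivAt f b t := e ▸ h

theorem inv_sub_comm (s t : ℝ) : (s - t)⁻¹ = -(t-s)⁻¹ := by
  rw [← inv_neg]; congr 1; ring

/-- The second kind of terms. -/
theorem pd_two (z : Fin 4 → ℝ) (hz : Good z) (i a b c : Fin 4)
    (hia : i ≠ a) (hib : i ≠ b) (hic : i ≠ c)
    (hP : ∀ q : Fin 4 → ℝ, Pfun q = 16 * q i * q a * q b * q c) :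
    pd i (fun p => Pfun p * Afun a i p * Bfun b c i p) z
      = 1/4 * ((z b)⁻¹*(z c)⁻¹)^2 *
        (3*((z i)⁻¹)^4*((z i - z a)⁻¹)^2 + 2*((z i)⁻¹)^3*((z i - z a)⁻¹)^3) := by
  refine pd_of_good (G := fun q => -1/4 * ((q b)⁻¹*(q c)⁻¹)^2 *
    (((q i)⁻¹)^3 * ((q i - q a)⁻¹)^2)) ?_ i hz ?_
  · intro q hq
    have h1 := hq.1 i
    have h2 := hq.1 a
    have h3 := hq.1 b
    have h4 := hq.1 c
    have h5 := hq.2 i a hia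
    have e : q a - q i = -(q i - q a) := by ring
    simp only [hP, Afun, Bfun, e]
    field_simp
    try ring
  · simp only [Function.update_self, Function.update_of_ne hia.symm,
      Function.update_of_ne hib.symm, Function.update_of_ne hic.symm]
    have d := (((hd_inv (z i) (hz.1 i)).pow 3).mul
      ((hd_sub (z i) (z a) (hz.2 i a hia)).pow 2)).const_mul
        (-1/4 * ((z b)⁻¹*(z c)⁻¹)^2)
    refine hd_of d ?_
    simp only [Pi.mul_apply, Pi.pow_apply, Pi.add_apply, Nat.cast_ofNat, Nat.add_one_sub_one]
    ring

/-- The fourth kind of terms. -/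
theorem pd_star (z : Fin 4 → ℝ) (hz : Good z) (i a b c : Fin 4)
    (hia : i ≠ a) (hib : i ≠ b) (hic : i ≠ c)
    (hP : ∀ q : Fin 4 → ℝ, Pfun q = 16 * q i * q a * q b * q c) :
    pd i (pd i (fun p => Pfun p * Afun a i p * Afun b i p * Afun c i p)) z
      = 1/4 * starT (z i) (z a) (z b) (z c) := by
  have h1 : ∀ q, Good q → pd i (fun p => Pfun p * Afun a i p * Afun b i p * Afun c i p) q
      = 1/4 * (((q i)⁻¹*(q i - q a)⁻¹*(q i - q b)⁻¹*(q i - q c)⁻¹)^2 *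
        (-2*((q i)⁻¹+(q i - q a)⁻¹+(q i - q b)⁻¹+(q i - q c)⁻¹))) := by
    intro z hz
    refine pd_of_good (G := fun q => 1/4 *
      ((q i)⁻¹*(q i - q a)⁻¹*(q i - q b)⁻¹*(q i - q c)⁻¹)^2) ?_ i hz ?_
    · intro q hq
      have h1 := hq.1 i
      have h2 := hq.1 a
      have h3 := hq.1 b
      have h4 := hq.1 c
      have h5 := hq.2 i a hia
      have h6 := hq.2 i b hib
      have h7 := hq.2 i c hic
      have e : q a - q i = -(q i - q a) := by ring
      have eb : q b - q i = -(q i - q b) := by ring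
      have ec : q c - q i = -(q i - q c) := by ring
      simp only [hP, Afun, e, eb, ec]
      field_simp
      try ring
    · simp only [Function.update_self, Function.update_of_ne hia.symm,
        Function.update_of_ne hib.symm, Function.update_of_ne hic.symm]
      have d := ((((hd_inv (z i) (hz.1 i)).mul (hd_sub (z i) (z a) (hz.2 i a hia))).mul
        (hd_sub (z i) (z b) (hz.2 i b hib))).mul
        (hd_sub (z i) (z c) (hz.2 i c hic))).pow 2 |>.const_mul (1/4)
      refine hd_of d ?_
      simp only [Pi.mul_apply, Pi.pow_apply, Pi.add_apply, Nat.cast_ofNat, Nat.add_one_sub_one]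
      ring
  refine pd_of_good h1 i hz ?_
  simp only [Function.update_self, Function.update_of_ne hia.symm,
        Function.update_of_ne hib.symm, Function.update_of_ne hic.symm]
  have d0 := hd_inv (z i) (hz.1 i)
  have da := hd_sub (z i) (z a) (hz.2 i a hia)
  have db := hd_sub (z i) (z b) (hz.2 i b hib)
  have dc := hd_sub (z i) (z c) (hz.2 i c hic)
  have d := (((((d0.mul da).mul db).mul dc).pow 2).mul
    ((((d0.add da).add db).add dc).const_mul (-2))).const_mul (1/4)
  refine hd_of d ?_
  simp only [Pi.mul_apply, Pi.pow_apply, Pi.add_apply, Nat.cast_ofNat, Nat.add_one_sub_one,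
    starT]
  ring

/-- The third kind of terms. -/
theorem pd_path (z : Fin 4 → ℝ) (hz : Good z) (i j a b : Fin 4)
    (hij : i ≠ j) (hia : i ≠ a) (hib : i ≠ b) (hja : j ≠ a) (hjb : j ≠ b)
    (hP : ∀ q : Fin 4 → ℝ, Pfun q = 16 * q i * q j * q a * q b) :
    pd i (pd j (fun p => Pfun p * Afun i j p * Afun a i p * Afun b j p)) z
      = 1/4 * pathT (z a) (z i) (z j) (z b) := by
  have h1 : ∀ q, Good q → pd j (fun p => Pfun p * Afun i j p * Afun a i p * Afun b j p) q
      = 1/4 * (q j)⁻¹ * ((q j - q b)⁻¹)^2 * ((q i)⁻¹ * ((q i - q j)⁻¹*(q i - q a)⁻¹)^2 *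
        (-(q j)⁻¹+2*(q i - q j)⁻¹-2*(q j - q b)⁻¹)) := by
    intro z hz
    refine pd_of_good (G := fun q => 1/4 * (q i)⁻¹ * ((q i - q a)⁻¹)^2 *
      ((q j)⁻¹ * ((q j - q i)⁻¹*(q j - q b)⁻¹)^2)) ?_ j hz ?_
    · intro q hq
      have h1 := hq.1 i
      have h2 := hq.1 a
      have h3 := hq.1 b
      have h4 := hq.1 j
      have h5 := hq.2 i a hia
      have h6 := hq.2 i j hij
      have h7 := hq.2 j b hjb
      have e : q a - q i = -(q i - q a) := by ring
      have eb : q j - q i = -(q i - q j) := by ring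
      have ec : q b - q j = -(q j - q b) := by ring
      simp only [hP, Afun, e, eb, ec]
      field_simp
      try ring
    · simp only [Function.update_self, Function.update_of_ne hij,
        Function.update_of_ne hja.symm, Function.update_of_ne hjb.symm]
      have d := ((hd_inv (z j) (hz.1 j)).mul (((hd_sub (z j) (z i) (hz.2 j i hij.symm)).mul
        (hd_sub (z j) (z b) (hz.2 j b hjb))).pow 2)).const_mul
          (1/4 * (z i)⁻¹ * ((z i - z a)⁻¹)^2)
      refine hd_of d ?_
      simp only [Pi.mul_apply, Pi.pow_apply, Pi.add_apply, Nat.cast_ofNat, Nat.add_one_sub_one,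
        inv_sub_comm (z j) (z i)]
      ring
  refine pd_of_good h1 i hz ?_
  simp only [Function.update_self, Function.update_of_ne hij.symm,
        Function.update_of_ne hia.symm, Function.update_of_ne hib.symm]
  have d0 := hd_inv (z i) (hz.1 i)
  have da := hd_sub (z i) (z a) (hz.2 i a hia)
  have dj := hd_sub (z i) (z j) (hz.2 i j hij)
  have d := ((d0.mul ((dj.mul da).pow 2)).mul
    (((dj.const_mul 2).const_add (-(z j)⁻¹)).sub_const (2*(z j - z b)⁻¹))).const_mul
      (1/4 * (z j)⁻¹ * ((z j - z b)⁻¹)^2)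
  refine hd_of d ?_
  simp only [Pi.mul_apply, Pi.pow_apply, Pi.add_apply, Nat.cast_ofNat, Nat.add_one_sub_one,
    pathT, inv_sub_comm (z j) (z i)]
  ring

theorem wfun_one (a i : Fin 4) : wfun {a} i = Afun a i := by
  simp [wfun]

theorem wfun_two (a b i : Fin 4) (h : a < b) : wfun {a, b} i = Bfun a b i := by
  have hc : ({a, b} : Finset (Fin 4)).card = 2 := Finset.card_pair h.ne
  have h1 : ({a, b} : Finset (Fin 4)).min' ⟨a, by simp⟩ = a := by
    apply le_antisymm
    · exact Finset.min'_le _ _ (by simp)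
    · apply Finset.le_min'; intro y hy; simp at hy; rcases hy with rfl | rfl
      · exact le_rfl
      · exact h.le
  have h2 : ({a, b} : Finset (Fin 4)).max' ⟨a, by simp⟩ = b := by
    apply le_antisymm
    · apply Finset.max'_le; intro y hy; simp at hy; rcases hy with rfl | rfl
      · exact h.le
      · exact le_rfl
    · exact Finset.le_max' _ _ (by simp)
  simp [wfun, hc, h1, h2]

/-- The inner sum over ordered pairs `(I₁, I₂)`. -/
theorem sum_two (z : Fin 4 → ℝ) (hz : Good z) (i a b c : Fin 4)
    (hia : i ≠ a) (hib : i ≠ b) (hic : i ≠ c) (hab : a < b) (hbc : b < c)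
    (hE : (Finset.univ.erase i : Finset (Fin 4)) = {a, b, c})
    (hP : ∀ q : Fin 4 → ℝ, Pfun q = 16 * q i * q a * q b * q c)
    (T : Fin 4 → Fin 4 → Fin 4 → ℝ)
    (hT : ∀ a b c, T a b c = 1/4 * ((z b)⁻¹*(z c)⁻¹)^2 *
        (3*((z i)⁻¹)^4*((z i - z a)⁻¹)^2 + 2*((z i)⁻¹)^3*((z i - z a)⁻¹)^3)) :
    ∑ I₁ ∈ (Finset.univ.erase i).powerset.filter
            (fun I₁ => I₁.Nonempty ∧ ((Finset.univ.erase i) \ I₁).Nonempty),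
          (1 / 2) * pd i (fun p =>
            Pfun p * wfun I₁ i p * wfun ((Finset.univ.erase i) \ I₁) i p) z
      = T a b c + T b a c + T c a b := by
  have hac := hab.trans hbc
  have hF : (Finset.univ.erase i).powerset.filter
            (fun I₁ => I₁.Nonempty ∧ ((Finset.univ.erase i) \ I₁).Nonempty)
      = {{a}, {b}, {c}, {a, b}, {a, c}, {b, c}} := by
    rw [hE]; clear * - hab hbc; revert a b c; decide
  have s1 : (Finset.univ.erase i : Finset (Fin 4)) \ {a} = {b, c} := by
    rw [hE]; clear * - hab hbc; revert a b c; decide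
  have s2 : (Finset.univ.erase i : Finset (Fin 4)) \ {b} = {a, c} := by
    rw [hE]; clear * - hab hbc; revert a b c; decide
  have s3 : (Finset.univ.erase i : Finset (Fin 4)) \ {c} = {a, b} := by
    rw [hE]; clear * - hab hbc; revert a b c; decide
  have s4 : (Finset.univ.erase i : Finset (Fin 4)) \ {a, b} = {c} := by
    rw [hE]; clear * - hab hbc; revert a b c; decide
  have s5 : (Finset.univ.erase i : Finset (Fin 4)) \ {a, c} = {b} := by
    rw [hE]; clear * - hab hbc; revert a b c; decide
  have s6 : (Finset.univ.erase i : Finset (Fin 4)) \ {b, c} = {a} := by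
    rw [hE]; clear * - hab hbc; revert a b c; decide
  have n1 : ({a} : Finset (Fin 4)) ∉ ({{b}, {c}, {a, b}, {a, c}, {b, c}} : Finset (Finset (Fin 4))) := by
    clear * - hab hbc; revert a b c; decide
  have n2 : ({b} : Finset (Fin 4)) ∉ ({{c}, {a, b}, {a, c}, {b, c}} : Finset (Finset (Fin 4))) := by
    clear * - hab hbc; revert a b c; decide
  have n3 : ({c} : Finset (Fin 4)) ∉ ({{a, b}, {a, c}, {b, c}} : Finset (Finset (Fin 4))) := by
    clear * - hab hbc; revert a b c; decide
  have n4 : ({a, b} : Finset (Fin 4)) ∉ ({{a, c}, {b, c}} : Finset (Finset (Fin 4))) := by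
    clear * - hab hbc; revert a b c; decide
  have n5 : ({a, c} : Finset (Fin 4)) ∉ ({{b, c}} : Finset (Finset (Fin 4))) := by
    clear * - hab hbc; revert a b c; decide
  rw [hF, Finset.sum_insert n1, Finset.sum_insert n2, Finset.sum_insert n3,
    Finset.sum_insert n4, Finset.sum_insert n5, Finset.sum_singleton,
    s1, s2, s3, s4, s5, s6]
  simp only [wfun_one, wfun_two _ _ _ hab, wfun_two _ _ _ hbc, wfun_two _ _ _ hac]
  have sw : ∀ (f g : (Fin 4 → ℝ) → ℝ), (fun p => Pfun p * f p * g p)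
      = (fun p => Pfun p * g p * f p) := by
    intro f g; funext p; ring
  rw [sw (Bfun a b i), sw (Bfun a c i), sw (Bfun b c i),
    pd_two z hz i a b c hia hib hic hP,
    pd_two z hz i b a c hib hia hic (by intro q; rw [hP]; ring),
    pd_two z hz i c a b hic hia hib (by intro q; rw [hP]; ring), hT, hT, hT]
  ring

theorem pathT_symm (a i j b : ℝ) : pathT a i j b = pathT b j i a := by
  simp only [pathT, inv_sub_comm j i]
  ring

/-- The sum over ordered triples `(a, b, c)`. -/
theorem sum_star (z : Fin 4 → ℝ) (hz : Good z) (i a b c : Fin 4)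
    (hia : i ≠ a) (hib : i ≠ b) (hic : i ≠ c) (hab : a ≠ b) (hac : a ≠ c) (hbc : b ≠ c)
    (hE : (Finset.univ.erase i : Finset (Fin 4)) = {a, b, c})
    (hP : ∀ q : Fin 4 → ℝ, Pfun q = 16 * q i * q a * q b * q c) :
    ∑ a ∈ Finset.univ.erase i,
          ∑ b ∈ (Finset.univ.erase i).erase a,
          ∑ c ∈ ((Finset.univ.erase i).erase a).erase b,
          (1 / 6) * pd i (pd i (fun p =>
            Pfun p * Afun a i p * Afun b i p * Afun c i p)) z
      = 1/4 * starT (z i) (z a) (z b) (z c) := by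
  have key : ∀ f : Fin 4 → Fin 4 → Fin 4 → ℝ, ∑ a ∈ Finset.univ.erase i,
          ∑ b ∈ (Finset.univ.erase i).erase a,
          ∑ c ∈ ((Finset.univ.erase i).erase a).erase b, f a b c
      = f a b c + f a c b + f b a c + f b c a + f c a b + f c b a := by
    intro f
    have e1 : ({a, b, c} : Finset (Fin 4)).erase a = {b, c} := by
      clear * - hab hac hbc; revert a b c; decide
    have e2 : ({a, b, c} : Finset (Fin 4)).erase b = {a, c} := by
      clear * - hab hac hbc; revert a b c; decide
    have e3 : ({a, b, c} : Finset (Fin 4)).erase c = {a, b} := by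
      clear * - hab hac hbc; revert a b c; decide
    have g : ∀ s t : Fin 4, s ≠ t → ({s, t} : Finset (Fin 4)).erase s = {t} := by decide
    have gr : ∀ s t : Fin 4, s ≠ t → ({s, t} : Finset (Fin 4)).erase t = {s} := by decide
    rw [hE, Finset.sum_insert (by simp [hab, hac]), Finset.sum_pair hbc, e1, e2, e3,
      Finset.sum_pair hbc, Finset.sum_pair hac, Finset.sum_pair hab,
      g _ _ hab, g _ _ hbc, g _ _ hac, gr _ _ hab, gr _ _ hbc, gr _ _ hac]
    simp only [Finset.sum_singleton]
    ring
  rw [key, pd_star z hz i a b c hia hib hic hP,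
    pd_star z hz i a c b hia hic hib (by intro q; rw [hP]; ring),
    pd_star z hz i b a c hib hia hic (by intro q; rw [hP]; ring),
    pd_star z hz i b c a hib hic hia (by intro q; rw [hP]; ring),
    pd_star z hz i c a b hic hia hib (by intro q; rw [hP]; ring),
    pd_star z hz i c b a hic hib hia (by intro q; rw [hP]; ring)]
  simp only [starT]
  ring

/-- The sum over `j` and ordered pairs `(a, b)`. -/
theorem sum_path (z : Fin 4 → ℝ) (hz : Good z) (i a b c : Fin 4)
    (hia : i ≠ a) (hib : i ≠ b) (hic : i ≠ c) (hab : a ≠ b) (hac : a ≠ c) (hbc : b ≠ c)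
    (hE : (Finset.univ.erase i : Finset (Fin 4)) = {a, b, c})
    (hP : ∀ q : Fin 4 → ℝ, Pfun q = 16 * q i * q a * q b * q c) :
    ∑ j ∈ Finset.univ.erase i,
          ∑ a ∈ (Finset.univ.erase i).erase j,
          ∑ b ∈ ((Finset.univ.erase i).erase j).erase a,
          (1 / 2) * pd i (pd j (fun p =>
            Pfun p * Afun i j p * Afun a i p * Afun b j p)) z
      = 1/8 * (pathT (z b) (z i) (z a) (z c) + pathT (z c) (z i) (z a) (z b)
        + pathT (z a) (z i) (z b) (z c) + pathT (z c) (z i) (z b) (z a)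
        + pathT (z a) (z i) (z c) (z b) + pathT (z b) (z i) (z c) (z a)) := by
  have key : ∀ f : Fin 4 → Fin 4 → Fin 4 → ℝ, ∑ a ∈ Finset.univ.erase i,
          ∑ b ∈ (Finset.univ.erase i).erase a,
          ∑ c ∈ ((Finset.univ.erase i).erase a).erase b, f a b c
      = f a b c + f a c b + f b a c + f b c a + f c a b + f c b a := by
    intro f
    have e1 : ({a, b, c} : Finset (Fin 4)).erase a = {b, c} := by
      clear * - hab hac hbc; revert a b c; decide
    have e2 : ({a, b, c} : Finset (Fin 4)).erase b = {a, c} := by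
      clear * - hab hac hbc; revert a b c; decide
    have e3 : ({a, b, c} : Finset (Fin 4)).erase c = {a, b} := by
      clear * - hab hac hbc; revert a b c; decide
    have g : ∀ s t : Fin 4, s ≠ t → ({s, t} : Finset (Fin 4)).erase s = {t} := by decide
    have gr : ∀ s t : Fin 4, s ≠ t → ({s, t} : Finset (Fin 4)).erase t = {s} := by decide
    rw [hE, Finset.sum_insert (by simp [hab, hac]), Finset.sum_pair hbc, e1, e2, e3,
      Finset.sum_pair hbc, Finset.sum_pair hac, Finset.sum_pair hab,
      g _ _ hab, g _ _ hbc, g _ _ hac, gr _ _ hab, gr _ _ hbc, gr _ _ hac]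
    simp only [Finset.sum_singleton]
    ring
  rw [key, pd_path z hz i a b c hia hib hic hab hac hP,
    pd_path z hz i a c b hia hic hib hac hab (by intro q; rw [hP]; ring),
    pd_path z hz i b a c hib hia hic hab.symm hbc (by intro q; rw [hP]; ring),
    pd_path z hz i b c a hib hic hia hbc hab.symm (by intro q; rw [hP]; ring),
    pd_path z hz i c a b hic hia hib hac.symm hbc.symm (by intro q; rw [hP]; ring),
    pd_path z hz i c b a hic hib hia hbc.symm hac.symm (by intro q; rw [hP]; ring)]
  ring

theorem airy_W04_vanishes (z : Fin 4 → ℝ) (hz : ∀ i, z i ≠ 0)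
    (hinj : Function.Injective z) :
    0 = Pfun z * W4fun z
      - ∑ i : Fin 4, ∑ I₁ ∈ (Finset.univ.erase i).powerset.filter
            (fun I₁ => I₁.Nonempty ∧ ((Finset.univ.erase i) \ I₁).Nonempty),
          (1 / 2) * pd i (fun p =>
            Pfun p * wfun I₁ i p * wfun ((Finset.univ.erase i) \ I₁) i p) z
      + ∑ i : Fin 4, ∑ j ∈ Finset.univ.erase i,
          ∑ a ∈ (Finset.univ.erase i).erase j,
          ∑ b ∈ ((Finset.univ.erase i).erase j).erase a,
          (1 / 2) * pd i (pd j (fun p =>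
            Pfun p * Afun i j p * Afun a i p * Afun b j p)) z
      + ∑ i : Fin 4,
          ∑ a ∈ Finset.univ.erase i,
          ∑ b ∈ (Finset.univ.erase i).erase a,
          ∑ c ∈ ((Finset.univ.erase i).erase a).erase b,
          (1 / 6) * pd i (pd i (fun p =>
            Pfun p * Afun a i p * Afun b i p * Afun c i p)) z := by
  have hg : Good z := ⟨hz, fun i j hij => sub_ne_zero.mpr (fun h => hij (hinj h))⟩
  have P0 : ∀ q : Fin 4 → ℝ, Pfun q = 16 * q 0 * q 1 * q 2 * q 3 := fun q => rfl
  have P1 : ∀ q : Fin 4 → ℝ, Pfun q = 16 * q 1 * q 0 * q 2 * q 3 := fun q => by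
    rw [P0]; ring
  have P2 : ∀ q : Fin 4 → ℝ, Pfun q = 16 * q 2 * q 0 * q 1 * q 3 := fun q => by
    rw [P0]; ring
  have P3 : ∀ q : Fin 4 → ℝ, Pfun q = 16 * q 3 * q 0 * q 1 * q 2 := fun q => by
    rw [P0]; ring
  rw [Fin.sum_univ_four, Fin.sum_univ_four, Fin.sum_univ_four,
    sum_two z hg 0 1 2 3 (by decide) (by decide) (by decide) (by decide) (by decide)
      (by decide) P0 _ (fun _ _ _ => rfl),
    sum_two z hg 1 0 2 3 (by decide) (by decide) (by decide) (by decide) (by decide)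
      (by decide) P1 _ (fun _ _ _ => rfl),
    sum_two z hg 2 0 1 3 (by decide) (by decide) (by decide) (by decide) (by decide)
      (by decide) P2 _ (fun _ _ _ => rfl),
    sum_two z hg 3 0 1 2 (by decide) (by decide) (by decide) (by decide) (by decide)
      (by decide) P3 _ (fun _ _ _ => rfl),
    sum_star z hg 0 1 2 3 (by decide) (by decide) (by decide) (by decide) (by decide)
      (by decide) (by decide) P0,
    sum_star z hg 1 0 2 3 (by decide) (by decide) (by decide) (by decide) (by decide)
      (by decide) (by decide) P1,
    sum_star z hg 2 0 1 3 (by decide) (by decide) (by decide) (by decide) (by decide)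
      (by decide) (by decide) P2,
    sum_star z hg 3 0 1 2 (by decide) (by decide) (by decide) (by decide) (by decide)
      (by decide) (by decide) P3,
    sum_path z hg 0 1 2 3 (by decide) (by decide) (by decide) (by decide) (by decide)
      (by decide) (by decide) P0,
    sum_path z hg 1 0 2 3 (by decide) (by decide) (by decide) (by decide) (by decide)
      (by decide) (by decide) P1,
    sum_path z hg 2 0 1 3 (by decide) (by decide) (by decide) (by decide) (by decide)
      (by decide) (by decide) P2,
    sum_path z hg 3 0 1 2 (by decide) (by decide) (by decide) (by decide) (by decide)
      (by decide) (by decide) P3]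
  have hW : Pfun z * W4fun z = 3/4 * ((z 0)⁻¹*(z 1)⁻¹*(z 2)⁻¹*(z 3)⁻¹)^2 *
      (((z 0)⁻¹)^2+((z 1)⁻¹)^2+((z 2)⁻¹)^2+((z 3)⁻¹)^2) := by
    have a0 := hz 0
    have a1 := hz 1
    have a2 := hz 2
    have a3 := hz 3
    simp only [Pfun, W4fun, zpow_neg]
    norm_cast
    field_simp
    try ring
  have ht := tree_sum (z 0) (z 1) (z 2) (z 3) (hz 0) (hz 1) (hz 2) (hz 3)
    (hg.2 3 0 (by decide)) (hg.2 3 1 (by decide)) (hg.2 3 2 (by decide))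
    (hg.2 0 1 (by decide)) (hg.2 0 2 (by decide)) (hg.2 1 2 (by decide))
  have q01 := pair_id (z 0) (z 1) (hz 0) (hz 1) (hg.2 0 1 (by decide))
  have q02 := pair_id (z 0) (z 2) (hz 0) (hz 2) (hg.2 0 2 (by decide))
  have q03 := pair_id (z 0) (z 3) (hz 0) (hz 3) (hg.2 0 3 (by decide))
  have q12 := pair_id (z 1) (z 2) (hz 1) (hz 2) (hg.2 1 2 (by decide))
  have q13 := pair_id (z 1) (z 3) (hz 1) (hz 3) (hg.2 1 3 (by decide))
  have q23 := pair_id (z 2) (z 3) (hz 2) (hz 3) (hg.2 2 3 (by decide))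
  rw [hW, inv_sub_comm (z 1) (z 0), inv_sub_comm (z 2) (z 0), inv_sub_comm (z 3) (z 0),
    inv_sub_comm (z 2) (z 1), inv_sub_comm (z 3) (z 1), inv_sub_comm (z 3) (z 2)]
  generalize z 0 = x at *
  generalize z 1 = y at *
  generalize z 2 = u at *
  generalize z 3 = w at *
  -- each path is met twice, once from either end
  linear_combination (-1/4) * ht
    - 1/8 * (pathT_symm u y w x +
      pathT_symm y u w x +
      pathT_symm u x w y +
      pathT_symm x u w y +
      pathT_symm y x w u +
      pathT_symm x y w u +
      pathT_symm u y x w +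
      pathT_symm y u x w +
      pathT_symm u x y w +
      pathT_symm x u y w +
      pathT_symm y x u w +
      pathT_symm x y u w)
    + 1/4 * (u⁻¹*w⁻¹)^2 * q01 + 1/4 * (y⁻¹*w⁻¹)^2 * q02 + 1/4 * (y⁻¹*u⁻¹)^2 * q03
    + 1/4 * (x⁻¹*w⁻¹)^2 * q12 + 1/4 * (x⁻¹*u⁻¹)^2 * q13 + 1/4 * (x⁻¹*y⁻¹)^2 * q23
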